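/- The L-series L(5,χ_8) = Σ_{n=1}^∞ χ_8(n)/n⁵ = (1 + 1/2⁵ + 1/3⁵ − 1/5⁵ − 1/6⁵ − 1/7⁵) + (1/9⁵ + 1/10⁵ + 1/11⁵ − 1/13⁵ − 1/14⁵ − 1/15⁵) + ⋯ equals π⁵(5 + 114√2)/49152. -/

import Mathlib

/-- The symmetric function `χ_{2m}` mod `2m`: value `1` on residues `1,…,m-1`,
`0` on residues `0` and `m`, and `-1` on residues `m+1,…,2m-1`. -/
noncomputable def chi2m (m : ℕ) : ℤ → ℂ := fun n =>
  let a := n % (2 * m)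
  if a = 0 then 0
  else if a < m then 1
  else if a = m then 0
  else -1

theorem aux_bern (x : ℝ) :
    (Polynomial.map (algebraMap ℚ ℝ) (Polynomial.bernoulli (2 * 2 + 1))).eval x
      = x ^ 5 - 5 / 2 * x ^ 4 + 5 / 3 * x ^ 3 - x / 6 := by
  have h3 : _root_.bernoulli 3 = 0 := bernoulli_eq_zero_of_odd (by decide) (by decide)
  have h5 : _root_.bernoulli 5 = 0 := bernoulli_eq_zero_of_odd (by decide) (by decide)
  have h4 : _root_.bernoulli 4 = -1 / 30 := by
    rw [bernoulli_eq_bernoulli'_of_ne_one (by decide), bernoulli'_four]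
  have h2 : _root_.bernoulli 2 = 1 / 6 := by
    rw [bernoulli_eq_bernoulli'_of_ne_one (by decide), bernoulli'_two]
  have c2 : Nat.choose 5 2 = 10 := by decide
  have c3 : Nat.choose 5 3 = 10 := by decide
  simp [Polynomial.bernoulli, Finset.sum_range_succ, h2, h3, h4, h5, c2, c3,
    bernoulli_one, bernoulli_zero]
  ring

theorem aux_sin (q r : ℕ) (c : ℕ) :
    Real.sin (2 * Real.pi * ((8 * q + r : ℕ) : ℝ) * (c / 8)) =
      Real.sin (Real.pi / 4 * (r * c : ℕ)) := by
  rw [← Real.sin_add_nat_mul_two_pi (Real.pi / 4 * (r * c : ℕ)) (q * c)]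
  congr 1
  push_cast
  ring

theorem aux_vals : Real.sin (Real.pi / 4) = √2 / 2 ∧ ∀ k : ℕ,
    Real.sin (Real.pi / 4 * ((k + 4 : ℕ) : ℝ)) = - Real.sin (Real.pi / 4 * (k : ℝ)) := by
  refine ⟨Real.sin_pi_div_four, fun k => ?_⟩
  rw [← Real.sin_add_pi]
  congr 1
  push_cast
  ring

set_option maxHeartbeats 1000000 in
theorem aux_term (n : ℕ) : chi2m 4 (n : ℤ) =
    (((√2 + 1) / 2 * Real.sin (2 * Real.pi * (n : ℝ) * ((1 : ℕ) / 8)) +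
      (√2 - 1) / 2 * Real.sin (2 * Real.pi * (n : ℝ) * ((3 : ℕ) / 8)) : ℝ) : ℂ) := by
  obtain ⟨v1, v⟩ := aux_vals
  have w0 : Real.sin (Real.pi / 4 * ((0 : ℕ) : ℝ)) = 0 := by simp
  have w1 : Real.sin (Real.pi / 4 * ((1 : ℕ) : ℝ)) = √2 / 2 := by simp
  have w2 : Real.sin (Real.pi / 4 * ((2 : ℕ) : ℝ)) = 1 := by
    rw [← Real.sin_pi_div_two]; congr 1; push_cast; ring
  have w3 : Real.sin (Real.pi / 4 * ((3 : ℕ) : ℝ)) = √2 / 2 := by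
    rw [← v1, ← Real.sin_pi_sub]; congr 1; push_cast; ring
  have w4 := v 0
  have w5 := v 1
  have w6 := v 2
  have w7 := v 3
  have w9 := v 5
  have w12 := v 8
  have w8 := v 4
  have w15 := v 11
  have w11 := v 7
  have w18 := v 14
  have w14 := v 10
  have w10 := v 6
  have w21 := v 17
  have w17 := v 13
  have w13 := v 9
  norm_num only at w0 w1 w2 w3 w4 w5 w6 w7 w8 w9 w10 w11 w12 w13 w14 w15 w17 w18 w21
  have hs : √2 * √2 = 2 := Real.mul_self_sqrt (by norm_num)
  obtain ⟨q, r, hr, rfl⟩ : ∃ q r : ℕ, r < 8 ∧ n = 8 * q + r :=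
    ⟨n / 8, n % 8, Nat.mod_lt _ (by norm_num), by omega⟩
  have hc : chi2m 4 ((8 * q + r : ℕ) : ℤ) = chi2m 4 (r : ℤ) := by
    unfold chi2m
    have : (((8 * q + r : ℕ) : ℤ) % (2 * (4 : ℕ))) = (r : ℤ) % (2 * (4 : ℕ)) := by
      push_cast; omega
    simp only [this]
  rw [hc, aux_sin, aux_sin]
  have key : ∀ z : ℂ, ∀ y x : ℝ, z = (x : ℂ) → x = y → z = (y : ℂ) := by
    rintro z y x h rfl; exact h
  interval_cases r
  · refine key _ _ 0 (by simp [chi2m]) ?_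
    simp
  · refine key _ _ 1 (by simp [chi2m]) ?_
    norm_num only [*]; ring_nf at hs ⊢; linarith [hs]
  · refine key _ _ 1 (by simp [chi2m]) ?_
    norm_num only [*]; ring_nf at hs ⊢
  · refine key _ _ 1 (by simp [chi2m]) ?_
    norm_num only [*]; ring_nf at hs ⊢; linarith [hs]
  · refine key _ _ 0 (by simp [chi2m]) ?_
    norm_num only [*]; ring
  · refine key _ _ (-1) (by simp [chi2m]) ?_
    norm_num only [*]; ring_nf at hs ⊢; linarith [hs]
  · refine key _ _ (-1) (by simp [chi2m]) ?_
    norm_num only [*]; ring_nf at hs ⊢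
  · refine key _ _ (-1) (by simp [chi2m]) ?_
    norm_num only [*]; ring_nf at hs ⊢; linarith [hs]

/-- `L(5,χ_8) = Σ_(n=1)^∞ χ_8(n)/n^5` evaluated in closed form. -/
theorem lseries_chi8_five :
    ∑' n : ℕ, chi2m 4 (n + 1) / ((n : ℂ) + 1) ^ 5 =
      ((Real.pi ^ 5 * (5 + 114 * Real.sqrt 2) / 49152 : ℝ) : ℂ) := by
  have h1 := hasSum_one_div_nat_pow_mul_sin (k := 2) two_ne_zero
    (x := ((1 : ℕ) : ℝ) / 8) (by constructor <;> norm_num)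
  have h3 := hasSum_one_div_nat_pow_mul_sin (k := 2) two_ne_zero
    (x := ((3 : ℕ) : ℝ) / 8) (by constructor <;> norm_num)
  have h := (h1.mul_left ((√2 + 1) / 2)).add (h3.mul_left ((√2 - 1) / 2))
  rw [aux_bern, aux_bern] at h
  have h' := Complex.hasSum_ofReal.mpr h
  have h'' := (hasSum_nat_add_iff' 1).mpr h'
  refine (HasSum.tsum_eq ?_)
  convert! h'' using 1
  · ext n
    have := aux_term (n + 1)
    push_cast at this ⊢
    rw [this]
    ring
  · simp [Nat.factorial]
    ring
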